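/- Let $V$ be a separable Hilbert space and $g:\mathbb{R}^d\to V$ be infinitely differentiable with compact support. Then $\int_0^\infty\int_{\mathbb{R}^d}\|\nabla T_u g(x)\|^2\,dx\,du\;=\;\frac{1}{2}\int_{\mathbb{R}^d}\|g(x)\|_V^2\,dx,$ where $\|\nabla T_u g(x)\|^2=\sum_{j=1}^d\|\partial_{x_j}T_u g(x)\|_V^2$. -/

import Mathlib

open MeasureTheory ENNReal

/-- The heat kernel `G_t(x) = (4πt)^{-d/2} exp(-|x|²/(4t))` on `ℝ^d`. -/
noncomputable def heatKernel (d : ℕ) (t : ℝ) (x : EuclideanSpace ℝ (Fin d)) : ℝ :=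
  (4 * Real.pi * t) ^ (-(d : ℝ)/2) * Real.exp (-‖x‖^2 / (4*t))

/-- The heat semigroup `T_t h (x) = ∫_{ℝ^d} h(x-y) G_t(y) dy` (Bochner integral). -/
noncomputable def heatOp (d : ℕ) {V : Type*} [NormedAddCommGroup V] [NormedSpace ℝ V]
    [CompleteSpace V] (t : ℝ) (h : EuclideanSpace ℝ (Fin d) → V)
    (x : EuclideanSpace ℝ (Fin d)) : V :=
  ∫ y, heatKernel d t y • h (x - y)

/-- Squared norm of the spatial gradient of `T_t h` at `x`:
`‖∇ T_t h(x)‖² = ∑_{j=1}^d ‖∂_{x_j} T_t h(x)‖²`. -/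
noncomputable def gradHeatNormSq (d : ℕ) {V : Type*} [NormedAddCommGroup V]
    [NormedSpace ℝ V] [CompleteSpace V] (t : ℝ) (h : EuclideanSpace ℝ (Fin d) → V)
    (x : EuclideanSpace ℝ (Fin d)) : ℝ :=
  ∑ j : Fin d, ‖fderiv ℝ (heatOp d t h) x (EuclideanSpace.single j 1)‖^2

open scoped FourierTransform LineDeriv InnerProductSpace

/-- Every real Hilbert space embeds isometrically into a complex one. -/
theorem exists_linearIsometry_complex (V : Type*) [NormedAddCommGroup V] [InnerProductSpace ℝ V]
    [CompleteSpace V] :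
    ∃ s : Set V, Nonempty (V →ₗᵢ[ℝ] lp (fun _ : s => ℂ) 2) := by
  obtain ⟨w, b, -⟩ := exists_hilbertBasis ℝ V
  have hmem (f : lp (fun _ : w => ℝ) 2) : Memℓp (fun i => (f i : ℂ)) 2 :=
    memℓp_gen <| by simpa using (lp.memℓp f).summable (by norm_num)
  let J : lp (fun _ : w => ℝ) 2 →ₗᵢ[ℝ] lp (fun _ : w => ℂ) 2 :=
    { toFun := fun f => ⟨fun i => (f i : ℂ), hmem f⟩
      map_add' := fun f g => by ext i; exact Complex.ofReal_add _ _
      map_smul' := fun c f => by ext i; simp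
      norm_map' := fun f => by
        simp [lp.norm_eq_tsum_rpow (p := 2) (by norm_num)] }
  exact ⟨w, ⟨J.comp b.repr.toLinearIsometry⟩⟩

theorem hasTemperateGrowth_exp_neg_mul_norm_sq (E : Type*) [NormedAddCommGroup E]
    [InnerProductSpace ℝ E] {c : ℝ} (hc : 0 ≤ c) :
    (fun x : E => Real.exp (-c * ‖x‖ ^ 2)).HasTemperateGrowth := by
  refine Function.HasTemperateGrowth.comp' (g := Real.exp) (f := fun x : E => -c * ‖x‖ ^ 2)
    (t := Set.Iio 1) ?_ isOpen_Iio.uniqueDiffOn Real.contDiff_exp.contDiffOn (fun N => ?_)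
    (by fun_prop)
  · rintro - ⟨x, rfl⟩
    have : 0 ≤ c * ‖x‖ ^ 2 := by positivity
    simp only [Set.mem_Iio]
    linarith
  · refine ⟨0, Real.exp 1, by positivity, fun n _ x hx => ?_⟩
    rw [iteratedFDerivWithin_of_isOpen n isOpen_Iio hx, norm_iteratedFDeriv_eq_norm_iteratedDeriv,
      iteratedDeriv_eq_iterate, Real.iter_deriv_exp]
    simpa using hx.le

theorem integrable_heatKernel (d : ℕ) {t : ℝ} (ht : 0 < t) : Integrable (heatKernel d t) := by
  unfold heatKernel
  refine Integrable.const_mul ?_ _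
  have h := (GaussianFourier.integrable_cexp_neg_mul_sq_norm_add (V := EuclideanSpace ℝ (Fin d))
    (b := ((1 / (4 * t) : ℝ) : ℂ)) (by rw [Complex.ofReal_re]; positivity) 0 0).norm
  refine h.congr (.of_forall fun x => ?_)
  have hx : (-((1 / (4 * t) : ℝ) : ℂ) * ‖x‖ ^ 2 + 0 * (inner ℝ 0 x : ℝ)) =
      ((-‖x‖ ^ 2 / (4 * t) : ℝ) : ℂ) := by
    push_cast
    ring
  simp only [hx, Complex.norm_exp, Complex.ofReal_re]

theorem fourier_heatKernel (d : ℕ) {t : ℝ} (ht : 0 < t) (ξ : EuclideanSpace ℝ (Fin d)) :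
    𝓕 (fun x => (heatKernel d t x : ℂ)) ξ =
      (Real.exp (-(4 * Real.pi ^ 2 * t) * ‖ξ‖ ^ 2) : ℂ) := by
  have hb : 0 < ((1 / (4 * t) : ℝ) : ℂ).re := by rw [Complex.ofReal_re]; positivity
  have h := fourier_gaussian_innerProductSpace hb ξ
  have h1 : (fun x => (heatKernel d t x : ℂ)) = ((4 * Real.pi * t) ^ (-(d : ℝ)/2) : ℝ) •
      fun v : EuclideanSpace ℝ (Fin d) => Complex.exp (-((1 / (4 * t) : ℝ) : ℂ) * ‖v‖ ^ 2) := by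
    ext x
    simp only [heatKernel, Pi.smul_apply, Complex.real_smul]
    push_cast
    congr 2
    ring
  have h2 : 𝓕 (((4 * Real.pi * t) ^ (-(d : ℝ)/2) : ℝ) •
      fun v : EuclideanSpace ℝ (Fin d) => Complex.exp (-((1 / (4 * t) : ℝ) : ℂ) * ‖v‖ ^ 2)) ξ =
      ((4 * Real.pi * t) ^ (-(d : ℝ)/2) : ℝ) •
      𝓕 (fun v : EuclideanSpace ℝ (Fin d) =>
        Complex.exp (-((1 / (4 * t) : ℝ) : ℂ) * ‖v‖ ^ 2)) ξ := by
    simp only [Real.fourier_eq, Pi.smul_apply, ← integral_smul]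
    congr 1
    ext v
    rw [smul_comm]
  rw [h1, h2, h, Complex.real_smul]
  have h3 : (Real.pi / ((1 / (4 * t) : ℝ) : ℂ)) ^
      (Module.finrank ℝ (EuclideanSpace ℝ (Fin d)) / 2 : ℂ) =
      ((4 * Real.pi * t) ^ ((d : ℝ) / 2) : ℝ) := by
    rw [Complex.ofReal_cpow (by positivity)]
    congr 1
    · push_cast; field_simp
    · simp
  rw [h3, ← mul_assoc, ← Complex.ofReal_mul, ← Real.rpow_add (by positivity)]
  simp [neg_div]
  field_simp

section

variable {H : Type*} [NormedAddCommGroup H] [InnerProductSpace ℂ H] [CompleteSpace H] {d : ℕ}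

/-- The heat flow of a Schwartz function, defined as a Fourier multiplier. -/
noncomputable def heatSchwartz (t : ℝ) (g : SchwartzMap (EuclideanSpace ℝ (Fin d)) H) :
    SchwartzMap (EuclideanSpace ℝ (Fin d)) H :=
  𝓕⁻ (SchwartzMap.smulLeftCLM H
    (fun ξ : EuclideanSpace ℝ (Fin d) => Real.exp (-(4 * Real.pi ^ 2 * t) * ‖ξ‖ ^ 2)) (𝓕 g))

theorem fourier_heatSchwartz_apply {t : ℝ} (ht : 0 < t)
    (g : SchwartzMap (EuclideanSpace ℝ (Fin d)) H) (ξ : EuclideanSpace ℝ (Fin d)) :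
    𝓕 (heatSchwartz t g) ξ = Real.exp (-(4 * Real.pi ^ 2 * t) * ‖ξ‖ ^ 2) • 𝓕 g ξ := by
  rw [heatSchwartz, FourierTransform.fourier_fourierInv_eq, SchwartzMap.smulLeftCLM_apply_apply
    (hasTemperateGrowth_exp_neg_mul_norm_sq _ (by positivity))]

theorem heatOp_eq_convolution (t : ℝ) (g : EuclideanSpace ℝ (Fin d) → H) :
    heatOp d t g = convolution (fun x => (heatKernel d t x : ℂ)) g
      (ContinuousLinearMap.lsmul ℂ ℂ) volume := by
  ext x
  simp [heatOp, convolution]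

theorem heatOp_eq_heatSchwartz {t : ℝ} (ht : 0 < t)
    (g : SchwartzMap (EuclideanSpace ℝ (Fin d)) H) :
    heatOp d t g = heatSchwartz t g := by
  have hk : Integrable (fun x => (heatKernel d t x : ℂ)) := (integrable_heatKernel d ht).ofReal
  have hF : 𝓕 (heatOp d t g) = 𝓕 (heatSchwartz t g : EuclideanSpace ℝ (Fin d) → H) := by
    ext ξ
    rw [← SchwartzMap.fourier_coe, fourier_heatSchwartz_apply ht, heatOp_eq_convolution,
      Real.fourier_smul_convolution_eq hk g.integrable, fourier_heatKernel d ht,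
      SchwartzMap.fourier_coe, Complex.coe_smul]
  have hcont : Continuous (heatOp d t g) := by
    rw [heatOp_eq_convolution]
    refine BddAbove.continuous_convolution_right_of_integrable _ ?_ hk g.continuous
    exact ⟨SchwartzMap.seminorm ℝ 0 0 g, fun x ⟨y, hy⟩ => hy ▸ SchwartzMap.norm_le_seminorm ℝ g y⟩
  have hint : Integrable (heatOp d t g) := by
    rw [heatOp_eq_convolution]
    exact hk.integrable_convolution _ g.integrable
  rw [← hcont.fourierInv_fourier_eq hint, hF, ← SchwartzMap.fourier_coe,
    ← SchwartzMap.fourierInv_coe, FourierTransform.fourierInv_fourier_eq]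
  rw [hF, ← SchwartzMap.fourier_coe]
  exact SchwartzMap.integrable _

theorem integral_gradHeatNormSq_schwartz {t : ℝ} (ht : 0 < t)
    (g : SchwartzMap (EuclideanSpace ℝ (Fin d)) H) :
    ∫ x, gradHeatNormSq d t g x = ∫ ξ, 4 * Real.pi ^ 2 * ‖ξ‖ ^ 2 *
      Real.exp (-(8 * Real.pi ^ 2 * ‖ξ‖ ^ 2) * t) * ‖𝓕 g ξ‖ ^ 2 := by
  have hsq (f : SchwartzMap (EuclideanSpace ℝ (Fin d)) H) : Integrable fun x => ‖f x‖ ^ 2 :=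
    (f.memLp 2).integrable_norm_pow (by norm_num)
  have hgrad (x : EuclideanSpace ℝ (Fin d)) : gradHeatNormSq d t g x =
      ∑ j : Fin d, ‖(∂_{EuclideanSpace.single j (1 : ℝ)} (heatSchwartz t g) :
        SchwartzMap (EuclideanSpace ℝ (Fin d)) H) x‖ ^ 2 := by
    simp only [gradHeatNormSq, heatOp_eq_heatSchwartz ht, SchwartzMap.lineDerivOp_apply_eq_fderiv]
  simp_rw [hgrad]
  rw [integral_finsetSum _ fun j _ => hsq _]
  rw [Finset.sum_congr rfl fun j _ => (SchwartzMap.integral_norm_sq_fourier _).symm,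
    ← integral_finsetSum _ fun j _ => hsq _]
  congr 1
  ext ξ
  have hfourier (j : Fin d) :
      ‖𝓕 (∂_{EuclideanSpace.single j (1 : ℝ)} (heatSchwartz t g) :
        SchwartzMap (EuclideanSpace ℝ (Fin d)) H) ξ‖ ^ 2 =
      ‖ξ j‖ ^ 2 * (4 * Real.pi ^ 2 *
        Real.exp (-(8 * Real.pi ^ 2 * ‖ξ‖ ^ 2) * t) * ‖𝓕 g ξ‖ ^ 2) := by
    have hm : (inner ℝ · (EuclideanSpace.single j (1 : ℝ))).HasTemperateGrowth :=
      ((innerSL ℝ).flip _).hasTemperateGrowth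
    have hexp : Real.exp (-(8 * Real.pi ^ 2 * ‖ξ‖ ^ 2) * t) =
        Real.exp (-(4 * Real.pi ^ 2 * t) * ‖ξ‖ ^ 2) ^ 2 := by
      rw [← Real.exp_nat_mul]; congr 1; push_cast; ring
    rw [SchwartzMap.fourier_lineDerivOp_eq, smul_apply,
      SchwartzMap.smulLeftCLM_apply_apply hm, fourier_heatSchwartz_apply ht, hexp]
    simp only [norm_smul, EuclideanSpace.inner_single_right, norm_mul, Complex.norm_I,
      Complex.norm_real, Complex.norm_ofNat, Real.norm_eq_abs, abs_of_pos Real.pi_pos, Real.abs_exp]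
    simp [mul_pow]
    ring
  simp_rw [hfourier]
  rw [← Finset.sum_mul, ← EuclideanSpace.norm_sq_eq]
  ring

theorem integral_mul_exp_neg_mul {a : ℝ} (ha : 0 < a) :
    ∫ u in Set.Ioi (0 : ℝ), a * Real.exp (-(2 * a) * u) = 1 / 2 := by
  rw [integral_const_mul, integral_exp_mul_Ioi (by linarith)]
  simp
  field_simp

theorem grad_heat_plancherel_schwartz (hd : 1 ≤ d)
    (g : SchwartzMap (EuclideanSpace ℝ (Fin d)) H) :
    ∫ u in Set.Ioi (0:ℝ), ∫ x, gradHeatNormSq d u g x = (1 / 2) * ∫ x, ‖g x‖ ^ 2 := by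
  have : Nonempty (Fin d) := ⟨⟨0, hd⟩⟩
  have hinner : ∀ᵐ ξ : EuclideanSpace ℝ (Fin d), ∫ u in Set.Ioi (0:ℝ),
      4 * Real.pi ^ 2 * ‖ξ‖ ^ 2 * Real.exp (-(8 * Real.pi ^ 2 * ‖ξ‖ ^ 2) * u) * ‖𝓕 g ξ‖ ^ 2 =
      (1 / 2) * ‖𝓕 g ξ‖ ^ 2 := by
    filter_upwards [Measure.ae_ne volume (0 : EuclideanSpace ℝ (Fin d))] with ξ hξ
    have hpos : 0 < ‖ξ‖ := norm_pos_iff.mpr hξ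
    rw [integral_mul_const, ← integral_mul_exp_neg_mul
      (a := 4 * Real.pi ^ 2 * ‖ξ‖ ^ 2) (by positivity)]
    ring_nf
  have hcont : Continuous fun ξ => 𝓕 g ξ := (𝓕 g).continuous
  rw [setIntegral_congr_fun measurableSet_Ioi
    fun u hu => integral_gradHeatNormSq_schwartz (d := d) hu g, integral_integral_swap]
  · rw [integral_congr_ae hinner, integral_const_mul, SchwartzMap.integral_norm_sq_fourier]
  · rw [integrable_prod_iff']
    · constructor
      · filter_upwards [Measure.ae_ne volume (0 : EuclideanSpace ℝ (Fin d))] with ξ hξ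
        have hpos : 0 < ‖ξ‖ := norm_pos_iff.mpr hξ
        have hexp := integrableOn_exp_mul_Ioi
          (neg_neg_of_pos (by positivity : 0 < 8 * Real.pi ^ 2 * ‖ξ‖ ^ 2)) 0
        exact (hexp.integrable.const_mul (4 * Real.pi ^ 2 * ‖ξ‖ ^ 2)).mul_const (‖𝓕 g ξ‖ ^ 2)
      · refine ((((𝓕 g).memLp 2).integrable_norm_pow (by norm_num)).const_mul (1 / 2)).congr ?_
        filter_upwards [hinner] with ξ hξ
        rw [← hξ]
        refine integral_congr_ae (.of_forall fun u => ?_)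
        simp only [Function.uncurry]
        rw [Real.norm_of_nonneg (by positivity)]
    · refine Continuous.aestronglyMeasurable ?_
      simp only [Function.uncurry_def]
      fun_prop

end

theorem differentiable_heatOp {V : Type*} [NormedAddCommGroup V] [NormedSpace ℝ V]
    [CompleteSpace V] {d : ℕ} {t : ℝ} (ht : 0 < t) {g : EuclideanSpace ℝ (Fin d) → V}
    (hg : ContDiff ℝ 1 g) (hsupp : HasCompactSupport g) : Differentiable ℝ (heatOp d t g) := by
  have h : heatOp d t g = convolution (heatKernel d t) g (ContinuousLinearMap.lsmul ℝ ℝ) volume := by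
    ext x
    simp [heatOp, convolution]
  rw [h]
  exact fun x => (hsupp.hasFDerivAt_convolution_right _
    (integrable_heatKernel d ht).locallyIntegrable hg x).differentiableAt

theorem gradHeatNormSq_linearIsometry_comp {V W : Type*} [NormedAddCommGroup V] [NormedSpace ℝ V]
    [CompleteSpace V] [NormedAddCommGroup W] [NormedSpace ℝ W] [CompleteSpace W]
    (J : V →ₗᵢ[ℝ] W) {d : ℕ} {t : ℝ} (ht : 0 < t) {g : EuclideanSpace ℝ (Fin d) → V}
    (hg : ContDiff ℝ 1 g) (hsupp : HasCompactSupport g) (x : EuclideanSpace ℝ (Fin d)) :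
    gradHeatNormSq d t (J ∘ g) x = gradHeatNormSq d t g x := by
  have h : heatOp d t (J ∘ g) = J ∘ heatOp d t g := by
    ext x
    simp [heatOp, ← J.integral_comp_comm]
  have hJ : HasFDerivAt (J ∘ heatOp d t g) (J.toContinuousLinearMap ∘L fderiv ℝ (heatOp d t g) x) x :=
    J.toContinuousLinearMap.hasFDerivAt.comp x (differentiable_heatOp ht hg hsupp x).hasFDerivAt
  simp [gradHeatNormSq, h, hJ.fderiv]

/-- Plancherel-type identity for the gradient of the heat semigroup:
for a smooth compactly supported `g : ℝ^d → V` (`V` a separable Hilbert space),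
`∫_0^∞ ∫_{ℝ^d} ‖∇T_u g(x)‖² dx du = (1/2) ∫_{ℝ^d} ‖g(x)‖² dx`. -/
theorem grad_heat_plancherel (d : ℕ) (hd : 1 ≤ d)
    (V : Type*) [NormedAddCommGroup V] [InnerProductSpace ℝ V] [CompleteSpace V]
    [TopologicalSpace.SeparableSpace V]
    (g : EuclideanSpace ℝ (Fin d) → V)
    (hsmooth : ContDiff ℝ (⊤ : ℕ∞) g) (hsupp : HasCompactSupport g) :
    (∫ u in Set.Ioi (0:ℝ), ∫ x : EuclideanSpace ℝ (Fin d), gradHeatNormSq d u g x)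
      = (1/2) * ∫ x : EuclideanSpace ℝ (Fin d), ‖g x‖^2 := by
  obtain ⟨_, ⟨J⟩⟩ := exists_linearIsometry_complex V
  have hJ : ContDiff ℝ (⊤ : ℕ∞) (J ∘ g) := J.contDiff.comp hsmooth
  have hJs : HasCompactSupport (J ∘ g) := hsupp.comp_left J.map_zero
  have h : ∫ u in Set.Ioi (0:ℝ), ∫ x, gradHeatNormSq d u (J ∘ g) x =
      (1 / 2) * ∫ x, ‖(J ∘ g) x‖ ^ 2 := grad_heat_plancherel_schwartz hd (hJs.toSchwartzMap hJ)
  simp only [Function.comp_apply, J.norm_map] at h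
  rw [← h]
  refine setIntegral_congr_fun measurableSet_Ioi fun u hu => ?_
  refine integral_congr_ae (.of_forall fun x => ?_)
  exact (gradHeatNormSq_linearIsometry_comp J hu (hsmooth.of_le (by norm_cast)) hsupp x).symm
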